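/- arXiv:nlin/0305031 — 3 statements merged into one kernel-verified Lean document; each statement's English description precedes it below -/
import Mathlib

section
/- Let τ ∈ ℂ with Im τ > 0 and let θ(z) = θ₁(z,τ). Then for all v, A, B, C, D ∈ ℂ the genus-one Fay identity holds: θ(A−B)·θ(D−C)·θ(v+A−D)·θ(v+C−B) + θ(A−D)·θ(C−B)·θ(v+A−B)·θ(v+C−D) = θ(A−C)·θ(D−B)·θ(v)·θ(v+A−B+C−D). -/
/-- The odd Jacobi theta function
`θ₁(z,τ) = -i ∑_{n ∈ ℤ} (-1)^n exp(iπτ(n+1/2)²) exp((2n+1)iπz)`. -/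
noncomputable def theta1 (z τ : ℂ) : ℂ :=
  -Complex.I * ∑' n : ℤ,
    (-1 : ℂ) ^ n * Complex.exp ((Real.pi : ℂ) * Complex.I * τ * ((n : ℂ) + 1 / 2) ^ 2) *
      Complex.exp ((2 * (n : ℂ) + 1) * (Real.pi : ℂ) * Complex.I * z)

open Complex in
/-- The `n`-th term of the theta series with characteristic `a`, with nome `exp (iπτ)` and
argument `z`. -/
noncomputable def thetaCharTerm (a z τ : ℂ) (n : ℤ) : ℂ :=
  cexp (Real.pi * I * τ * (n + a) ^ 2 + 2 * Real.pi * I * (n + a) * z)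

lemma summable_norm_thetaCharTerm (a z : ℂ) {τ : ℂ} (hτ : 0 < τ.im) :
    Summable fun n ↦ ‖thetaCharTerm a z τ n‖ := by
  have h := ((summable_jacobiTheta₂_term_iff (z + a * τ) τ).2 hτ).norm.mul_left
    ‖Complex.exp (Real.pi * Complex.I * τ * a ^ 2 + 2 * Real.pi * Complex.I * a * z)‖
  refine h.congr fun n ↦ ?_
  rw [← norm_mul, jacobiTheta₂_term, ← Complex.exp_add, thetaCharTerm]
  congr 2
  ring

/-- The two-term factorisation of `θ₁(x+y,τ) θ₁(x-y,τ)` through theta functions of modulus `2τ`. -/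
lemma theta1_add_mul_theta1_sub {τ : ℂ} (hτ : 0 < τ.im) (x y : ℂ) :
    theta1 (x + y) τ * theta1 (x - y) τ =
      (∑' k, thetaCharTerm 0 (2 * x) (2 * τ) k) * (∑' l, thetaCharTerm (1 / 2) (2 * y) (2 * τ) l) -
      (∑' k, thetaCharTerm 0 (2 * y) (2 * τ) k) *
        (∑' l, thetaCharTerm (1 / 2) (2 * x) (2 * τ) l) := by
  have hτ₂ : 0 < (2 * τ).im := by simpa using hτ
  have hneg : ∀ n : ℤ, ‖(-1 : ℂ) ^ n‖ = 1 := fun n ↦ by simp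
  have htheta : ∀ z, theta1 z τ =
      -Complex.I * ∑' n : ℤ, (-1 : ℂ) ^ n * thetaCharTerm (1 / 2) z τ n := fun z ↦ by
    rw [theta1]
    congr 2
    ext n
    rw [thetaCharTerm, mul_assoc, ← Complex.exp_add]
    congr 2
    ring
  have hsum : ∀ z, Summable fun n : ℤ ↦ ‖(-1 : ℂ) ^ n * thetaCharTerm (1 / 2) z τ n‖ := fun z ↦ by
    simpa only [norm_mul, hneg, one_mul] using summable_norm_thetaCharTerm (1 / 2) z hτ
  let e : (ℤ × ℤ) ⊕ (ℤ × ℤ) → ℤ × ℤ :=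
    Sum.elim (fun p ↦ (p.1 + p.2, p.1 - p.2 - 1)) (fun p ↦ (p.2 + p.1, p.2 - p.1))
  have he : e.Bijective := by
    constructor
    · rintro (⟨a, b⟩ | ⟨a, b⟩) (⟨c, d⟩ | ⟨c, d⟩) h <;>
        simp only [e, Sum.elim_inl, Sum.elim_inr, Prod.mk.injEq, Sum.inl.injEq, Sum.inr.injEq,
          reduceCtorEq] at h ⊢ <;> omega
    · rintro ⟨m, n⟩
      rcases Int.even_or_odd' (m + n) with ⟨s, hs | hs⟩
      · exact ⟨Sum.inr (m - s, s), by ext <;> simp only [e, Sum.elim_inr] <;> omega⟩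
      · exact ⟨Sum.inl (s + 1, m - s - 1), by ext <;> simp only [e, Sum.elim_inl] <;> omega⟩
  set f : ℤ × ℤ → ℂ := fun p ↦ ((-1 : ℂ) ^ p.1 * thetaCharTerm (1 / 2) (x + y) τ p.1) *
    ((-1 : ℂ) ^ p.2 * thetaCharTerm (1 / 2) (x - y) τ p.2) with hf
  have hsign : ∀ m n : ℤ, (-1 : ℂ) ^ m * (-1 : ℂ) ^ n = (-1) ^ (m + n) := fun m n ↦
    (zpow_add₀ (by norm_num) m n).symm
  have hinl : ∀ p : ℤ × ℤ, f (e (Sum.inl p)) =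
      -(thetaCharTerm 0 (2 * x) (2 * τ) p.1 * thetaCharTerm (1 / 2) (2 * y) (2 * τ) p.2) := by
    rintro ⟨k, l⟩
    simp only [hf, e, Sum.elim_inl]
    rw [mul_mul_mul_comm, hsign, Odd.neg_one_zpow ⟨k - 1, by ring⟩, neg_one_mul]
    simp only [thetaCharTerm, ← Complex.exp_add]
    congr 2
    push_cast
    ring
  have hinr : ∀ p : ℤ × ℤ, f (e (Sum.inr p)) =
      thetaCharTerm 0 (2 * y) (2 * τ) p.1 * thetaCharTerm (1 / 2) (2 * x) (2 * τ) p.2 := by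
    rintro ⟨k, l⟩
    simp only [hf, e, Sum.elim_inr]
    rw [mul_mul_mul_comm, hsign, Even.neg_one_zpow ⟨l, by ring⟩, one_mul]
    simp only [thetaCharTerm, ← Complex.exp_add]
    congr 1
    push_cast
    ring
  have hprod : ∀ u w : ℂ, Summable fun p : ℤ × ℤ ↦
      thetaCharTerm 0 (2 * u) (2 * τ) p.1 * thetaCharTerm (1 / 2) (2 * w) (2 * τ) p.2 := fun u w ↦
    summable_mul_of_summable_norm (summable_norm_thetaCharTerm _ _ hτ₂)
      (summable_norm_thetaCharTerm _ _ hτ₂)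
  have hsplit : ∑' p, f p =
      -((∑' k, thetaCharTerm 0 (2 * x) (2 * τ) k) *
        ∑' l, thetaCharTerm (1 / 2) (2 * y) (2 * τ) l) +
      (∑' k, thetaCharTerm 0 (2 * y) (2 * τ) k) *
        ∑' l, thetaCharTerm (1 / 2) (2 * x) (2 * τ) l := by
    rw [← (Equiv.ofBijective e he).tsum_eq f]
    have hl : (fun c ↦ f (Equiv.ofBijective e he c)) ∘ Sum.inl = _ := funext hinl
    have hr : (fun c ↦ f (Equiv.ofBijective e he c)) ∘ Sum.inr = _ := funext hinr
    refine (HasSum.sum ?_ ?_).tsum_eq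
    · rw [hl, tsum_mul_tsum_of_summable_norm (summable_norm_thetaCharTerm _ _ hτ₂)
        (summable_norm_thetaCharTerm _ _ hτ₂)]
      exact (hprod x y).hasSum.neg
    · rw [hr, tsum_mul_tsum_of_summable_norm (summable_norm_thetaCharTerm _ _ hτ₂)
        (summable_norm_thetaCharTerm _ _ hτ₂)]
      exact (hprod y x).hasSum
  rw [htheta, htheta, mul_mul_mul_comm, tsum_mul_tsum_of_summable_norm (hsum _) (hsum _), hsplit,
    neg_mul_neg, Complex.I_mul_I]
  ring

/-- Genus-one Fay identity for `θ(z) = θ₁(z,τ)`, `Im τ > 0`: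
`θ(A-B)θ(D-C)θ(v+A-D)θ(v+C-B) + θ(A-D)θ(C-B)θ(v+A-B)θ(v+C-D)
  = θ(A-C)θ(D-B)θ(v)θ(v+A-B+C-D)`. -/
theorem theta1_fay_identity (τ : ℂ) (hτ : 0 < τ.im) :
    ∀ v A B C D : ℂ,
      theta1 (A - B) τ * theta1 (D - C) τ * theta1 (v + A - D) τ *
          theta1 (v + C - B) τ +
        theta1 (A - D) τ * theta1 (C - B) τ * theta1 (v + A - B) τ *
          theta1 (v + C - D) τ =
      theta1 (A - C) τ * theta1 (D - B) τ * theta1 v τ *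
        theta1 (v + A - B + C - D) τ := by
  intro v A B C D
  set x₁ := v + (A - B + C - D) / 2
  set x₂ := (A - B + C - D) / 2
  set x₃ := (A + B - C - D) / 2
  set x₄ := (A - B - C + D) / 2
  have h₁₂ := theta1_add_mul_theta1_sub hτ x₁ x₂
  have h₁₃ := theta1_add_mul_theta1_sub hτ x₁ x₃
  have h₁₄ := theta1_add_mul_theta1_sub hτ x₁ x₄
  have h₂₃ := theta1_add_mul_theta1_sub hτ x₂ x₃
  have h₄₂ := theta1_add_mul_theta1_sub hτ x₄ x₂
  have h₄₃ := theta1_add_mul_theta1_sub hτ x₄ x₃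
  rw [show x₁ + x₂ = v + A - B + C - D by ring, show x₁ - x₂ = v by ring] at h₁₂
  rw [show x₁ + x₃ = v + A - D by ring, show x₁ - x₃ = v + C - B by ring] at h₁₃
  rw [show x₁ + x₄ = v + A - B by ring, show x₁ - x₄ = v + C - D by ring] at h₁₄
  rw [show x₂ + x₃ = A - D by ring, show x₂ - x₃ = C - B by ring] at h₂₃
  rw [show x₄ + x₂ = A - B by ring, show x₄ - x₂ = D - C by ring] at h₄₂
  rw [show x₄ + x₃ = A - C by ring, show x₄ - x₃ = D - B by ring] at h₄₃
  rw [h₄₂, h₂₃, h₄₃, mul_assoc, h₁₃, mul_assoc, h₁₄, mul_assoc, mul_comm (theta1 v τ), h₁₂]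
  ring
end

section
/- Fusion of the modified tetrahedron equation, one splitting step: Let G be an additive commutative group, let V₁, V₄, V₅ and V₂^(1), V₂^(2), V₃^(1), V₃^(2), V₆^(1), V₆^(2) be finite-dimensional complex vector spaces, and set V₂ = V₂^(1) ⊗ V₂^(2), V₃ = V₃^(1) ⊗ V₃^(2), V₆ = V₆^(1) ⊗ V₆^(2) and W = V₁ ⊗ V₂ ⊗ V₃ ⊗ V₄ ⊗ V₅ ⊗ V₆. Let ξ₁, ξ₂, η, ζ, υ ∈ G and ρ₁, ρ₂ ∈ ℂ. For a = 1,2 let R^(a)_{123}, R^(a)_{246}, R^(a)_{356} : G → End(W) be families acting as the identity outside V₁ ⊗ V₂^(a) ⊗ V₃^(a), respectively V₂^(a) ⊗ V₄ ⊗ V₆^(a), respectively V₃^(a) ⊗ V₅ ⊗ V₆^(a), and let S₁₄₅ : G → End(W) act as the identity outside V₁ ⊗ V₄ ⊗ V₅. Assume that for each a = 1,2 and every v ∈ G the modified tetrahedron equation holds: R^(a)_{123}(v) · S₁₄₅(v+ξ_a) · R^(a)_{246}(v) · R^(a)_{356}(v+ζ) = ρ_a · R^(a)_{356}(v) · R^(a)_{246}(v+η)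 · S₁₄₅(v) · R^(a)_{123}(v+υ). Define fused families R̂₁₂₃(v) = R^(1)_{123}(v) · R^(2)_{123}(v+ξ₁), R̂₂₄₆(v) = R^(2)_{246}(v+ξ₁) · R^(1)_{246}(v), R̂₃₅₆(v) = R^(2)_{356}(v+ξ₁) · R^(1)_{356}(v). Then for every v ∈ G: R̂₁₂₃(v) · S₁₄₅(v+ξ₁+ξ₂) · R̂₂₄₆(v) · R̂₃₅₆(v+ζ) = ρ₁ρ₂ · R̂₃₅₆(v) · R̂₂₄₆(v+η) · S₁₄₅(v) · R̂₁₂₃(v+υ). -/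
/-- A matrix `M` acting on the tensor product `⨂_k ℂ^{I k}` (realized as matrices
indexed by `∀ k, I k`) *acts as the identity outside* the tensor factors in `S` if it
is of the form `T ⊗ id`: there is a matrix `T` on the factors in `S` such that
`M p q = T (p|_S) (q|_S) · δ(p|_{Sᶜ}, q|_{Sᶜ})`. -/
def ActsAsIdOutside {ι : Type*} [Fintype ι] [DecidableEq ι] {I : ι → Type*}
    [∀ k, DecidableEq (I k)] (S : Finset ι)
    (M : Matrix (∀ k, I k) (∀ k, I k) ℂ) : Prop :=
  ∃ T : ((k : S) → I k.1) → ((k : S) → I k.1) → ℂ,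
    ∀ p q : ∀ k, I k,
      M p q = T (fun k => p k.1) (fun k => q k.1) *
        (if ∀ k ∉ S, p k = q k then 1 else 0)

theorem mul_apply_of_disjoint_supports {ι : Type*} [Fintype ι] [DecidableEq ι]
    {I : ι → Type*} [∀ k, Fintype (I k)] [∀ k, DecidableEq (I k)] {S S' : Finset ι}
    (hd : Disjoint S S') {M N : Matrix (∀ k, I k) (∀ k, I k) ℂ}
    {T : ((k : S) → I k.1) → ((k : S) → I k.1) → ℂ}
    {U : ((k : S') → I k.1) → ((k : S') → I k.1) → ℂ}
    (hM : ∀ p q, M p q = T (fun k => p k.1) (fun k => q k.1) *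
      (if ∀ k ∉ S, p k = q k then 1 else 0))
    (hN : ∀ p q, N p q = U (fun k => p k.1) (fun k => q k.1) *
      (if ∀ k ∉ S', p k = q k then 1 else 0))
    (p q : ∀ k, I k) :
    (M * N) p q = T (fun k => p k.1) (fun k => q k.1) * U (fun k => p k.1) (fun k => q k.1) *
      (if ∀ k, k ∉ S → k ∉ S' → p k = q k then 1 else 0) := by
  have hd' : ∀ k ∈ S, k ∉ S' := fun k h => Finset.disjoint_left.mp hd h
  have hd'' : ∀ k ∈ S', k ∉ S := fun k h => Finset.disjoint_right.mp hd h
  rw [Matrix.mul_apply, Finset.sum_eq_single (fun k => if k ∈ S then q k else p k)]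
  · have h1 : (fun k : S => if k.1 ∈ S then q k.1 else p k.1) = fun k : S => q k.1 := by
      funext k
      exact if_pos k.2
    have h2 : (fun k : S' => if k.1 ∈ S then q k.1 else p k.1) = fun k : S' => p k.1 := by
      funext k
      exact if_neg (hd'' k.1 k.2)
    have h3 : ∀ k ∉ S, p k = if k ∈ S then q k else p k := fun k hk => (if_neg hk).symm
    have h4 : (∀ k ∉ S', (if k ∈ S then q k else p k) = q k) ↔
        ∀ k, k ∉ S → k ∉ S' → p k = q k := by
      refine forall_congr' fun k => ?_
      by_cases hk : k ∈ S <;> simp [hk]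
    rw [hM, hN, h1, h2, if_pos h3]
    simp only [h4]
    ring
  · intro r _ hr
    rw [hM, hN]
    by_cases h1 : ∀ k ∉ S, p k = r k
    · by_cases h2 : ∀ k ∉ S', r k = q k
      · refine absurd (funext fun k => ?_) hr
        by_cases hk : k ∈ S
        · rw [if_pos hk, h2 k (hd' k hk)]
        · rw [if_neg hk, h1 k hk]
      · rw [if_neg h2, mul_zero, mul_zero]
    · rw [if_neg h1, mul_zero, zero_mul]
  · exact fun h => absurd (Finset.mem_univ _) h

theorem ActsAsIdOutside.commute {ι : Type*} [Fintype ι] [DecidableEq ι]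
    {I : ι → Type*} [∀ k, Fintype (I k)] [∀ k, DecidableEq (I k)] {S S' : Finset ι}
    {M N : Matrix (∀ k, I k) (∀ k, I k) ℂ}
    (hM : ActsAsIdOutside S M) (hN : ActsAsIdOutside S' N) (hd : Disjoint S S') :
    M * N = N * M := by
  obtain ⟨T, hT⟩ := hM
  obtain ⟨U, hU⟩ := hN
  ext p q
  rw [mul_apply_of_disjoint_supports hd hT hU, mul_apply_of_disjoint_supports hd.symm hU hT,
    mul_comm (T _ _)]
  congr 1
  refine if_congr (forall_congr' fun k => ?_) rfl rfl
  tauto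

/-- The splitting step in an arbitrary algebra, with the spectral shifts suppressed. -/
theorem fused_relation_of_commute {A : Type*} [Ring A] [Algebra ℂ A] {ρ₁ ρ₂ : ℂ}
    {a₁ a₂ b₁ b₂ c₁ c₂ a₁' a₂' b₁' b₂' c₁' c₂' s s' s'' : A}
    (h₁ : a₁ * s' * b₁ * c₁ = ρ₁ • (c₁' * b₁' * s * a₁'))
    (h₂ : a₂ * s'' * b₂ * c₂ = ρ₂ • (c₂' * b₂' * s' * a₂'))
    (hbc : b₁ * c₂ = c₂ * b₁) (hab : a₂' * b₁ = b₁ * a₂') (hac : a₂' * c₁ = c₁ * a₂')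
    (hac' : a₁ * c₂' = c₂' * a₁) (hab' : a₁ * b₂' = b₂' * a₁)
    (hbc' : b₂' * c₁' = c₁' * b₂') :
    a₁ * a₂ * s'' * (b₂ * b₁) * (c₂ * c₁) =
      (ρ₁ * ρ₂) • (c₂' * c₁' * (b₂' * b₁') * s * (a₁' * a₂')) := by
  calc a₁ * a₂ * s'' * (b₂ * b₁) * (c₂ * c₁)
      = a₁ * a₂ * s'' * b₂ * (b₁ * c₂) * c₁ := by noncomm_ring
    _ = a₁ * (a₂ * s'' * b₂ * c₂) * b₁ * c₁ := by rw [hbc]; noncomm_ring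
    _ = ρ₂ • (a₁ * c₂' * b₂' * s' * (a₂' * b₁) * c₁) := by
      rw [h₂]; simp only [mul_smul_comm, smul_mul_assoc, mul_assoc]
    _ = ρ₂ • (c₂' * (a₁ * b₂') * s' * b₁ * (a₂' * c₁)) := by
      rw [hac', hab]; simp only [mul_assoc]
    _ = ρ₂ • (c₂' * b₂' * (a₁ * s' * b₁ * c₁) * a₂') := by
      rw [hab', hac]; simp only [mul_assoc]
    _ = (ρ₁ * ρ₂) • (c₂' * (b₂' * c₁') * b₁' * s * a₁' * a₂') := by
      rw [h₁, mul_comm ρ₁, mul_smul]; simp only [mul_smul_comm, smul_mul_assoc, mul_assoc]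
    _ = _ := by rw [hbc']; simp only [mul_assoc]

/-- One step of fusion for the modified tetrahedron equation.
The nine tensor factors, indexed by `Fin 9`, are
`0 ↦ V₁`, `1 ↦ V₂⁽¹⁾`, `2 ↦ V₂⁽²⁾`, `3 ↦ V₃⁽¹⁾`, `4 ↦ V₃⁽²⁾`, `5 ↦ V₄`, `6 ↦ V₅`,
`7 ↦ V₆⁽¹⁾`, `8 ↦ V₆⁽²⁾` (each finite-dimensional space `V` realized as `ℂ^{I k}`,
endomorphisms of `W = ⨂_k V_k` as matrices indexed by `∀ k, I k`).
If for `a = 1, 2` the families `R⁽ᵃ⁾₁₂₃, R⁽ᵃ⁾₂₄₆, R⁽ᵃ⁾₃₅₆, S₁₄₅` satisfy the modified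
tetrahedron equation with shifts `ξ_a, η, ζ, υ` and scalars `ρ_a`, then the fused
families `R̂₁₂₃(v) = R⁽¹⁾₁₂₃(v)R⁽²⁾₁₂₃(v+ξ₁)`, `R̂₂₄₆(v) = R⁽²⁾₂₄₆(v+ξ₁)R⁽¹⁾₂₄₆(v)`,
`R̂₃₅₆(v) = R⁽²⁾₃₅₆(v+ξ₁)R⁽¹⁾₃₅₆(v)` satisfy the modified tetrahedron equation with
shifts `ξ₁+ξ₂, η, ζ, υ` and scalar `ρ₁ρ₂`. -/
theorem fused_mte_one_step {G : Type*} [AddCommGroup G]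
    {I : Fin 9 → Type*} [∀ k, Fintype (I k)] [∀ k, DecidableEq (I k)]
    (ξ₁ ξ₂ η ζ υ : G) (ρ₁ ρ₂ : ℂ)
    (R123₁ R123₂ R246₁ R246₂ R356₁ R356₂ S145 :
      G → Matrix (∀ k, I k) (∀ k, I k) ℂ)
    (hR123₁ : ∀ v, ActsAsIdOutside {0, 1, 3} (R123₁ v))
    (hR123₂ : ∀ v, ActsAsIdOutside {0, 2, 4} (R123₂ v))
    (hR246₁ : ∀ v, ActsAsIdOutside {1, 5, 7} (R246₁ v))
    (hR246₂ : ∀ v, ActsAsIdOutside {2, 5, 8} (R246₂ v))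
    (hR356₁ : ∀ v, ActsAsIdOutside {3, 6, 7} (R356₁ v))
    (hR356₂ : ∀ v, ActsAsIdOutside {4, 6, 8} (R356₂ v))
    (hS145 : ∀ v, ActsAsIdOutside {0, 5, 6} (S145 v))
    (hMTE₁ : ∀ v, R123₁ v * S145 (v + ξ₁) * R246₁ v * R356₁ (v + ζ) =
      ρ₁ • (R356₁ v * R246₁ (v + η) * S145 v * R123₁ (v + υ)))
    (hMTE₂ : ∀ v, R123₂ v * S145 (v + ξ₂) * R246₂ v * R356₂ (v + ζ) =
      ρ₂ • (R356₂ v * R246₂ (v + η) * S145 v * R123₂ (v + υ)))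
    (Rf123 Rf246 Rf356 : G → Matrix (∀ k, I k) (∀ k, I k) ℂ)
    (hRf123 : ∀ v, Rf123 v = R123₁ v * R123₂ (v + ξ₁))
    (hRf246 : ∀ v, Rf246 v = R246₂ (v + ξ₁) * R246₁ v)
    (hRf356 : ∀ v, Rf356 v = R356₂ (v + ξ₁) * R356₁ v) :
    ∀ v, Rf123 v * S145 (v + ξ₁ + ξ₂) * Rf246 v * Rf356 (v + ζ) =
      (ρ₁ * ρ₂) • (Rf356 v * Rf246 (v + η) * S145 v * Rf123 (v + υ)) := by
  intro v
  have h₂ := hMTE₂ (v + ξ₁)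
  rw [hRf123, hRf123, hRf246, hRf246, hRf356, hRf356, add_right_comm v ζ ξ₁,
    add_right_comm v η ξ₁, add_right_comm v υ ξ₁]
  exact fused_relation_of_commute (hMTE₁ v) h₂
    ((hR246₁ _).commute (hR356₂ _) (by decide))
    ((hR123₂ _).commute (hR246₁ _) (by decide))
    ((hR123₂ _).commute (hR356₁ _) (by decide))
    ((hR123₁ _).commute (hR356₂ _) (by decide))
    ((hR123₁ _).commute (hR246₂ _) (by decide))
    ((hR246₂ _).commute (hR356₁ _) (by decide))
end

section
/- Tetrahedron equation for fused weights when the total shifts vanish (abstract form of Theorem 3): In the setting of the fused modified tetrahedron equation — local operator families R^{XYZ}_{n₁n₂n₃}, R^{UYZ}_{n₀n₂n₃}, R^{UXZ}_{n₀n₁n₃}, R^{UXY}_{n₀n₁n₂} : G → End(W) acting as the identity outside their three specified tensor factors, satisfying for all indices and all v ∈ G the local modified tetrahedron equation R^{XYZ}_{n₁n₂n₃}(v) R^{UYZ}_{n₀n₂n₃}(v+x_{n₁}) R^{UXZ}_{n₀n₁n₃}(v) R^{UXY}_{n₀n₁n₂}(v+z_{n₃}) = ρ_{n₀n₁n₂n₃}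 R^{UXY}_{n₀n₁n₂}(v) R^{UXZ}_{n₀n₁n₃}(v+y_{n₂}) R^{UYZ}_{n₀n₂n₃}(v) R^{XYZ}_{n₁n₂n₃}(v+u_{n₀}) — assume in addition that Σ_{n₀} u_{n₀} = Σ_{n₁} x_{n₁} = Σ_{n₂} y_{n₂} = Σ_{n₃} z_{n₃} = 0 in G and that ∏_{n₀,n₁,n₂,n₃} ρ_{n₀n₁n₂n₃} = 1. Then the fused box operators satisfy, for every v ∈ G, the ordinary tetrahedron equation Rf^{XYZ}(v) · Rf^{UYZ}(v) · Rf^{UXZ}(v) · Rf^{UXY}(v) = Rf^{UXY}(v) · Rf^{UXZ}(v) · Rf^{UYZ}(v) · Rf^{XYZ}(v). -/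
/-- The index set labelling the tensor factors of the total space
`W = (⨂ A_{n₂n₃}) ⊗ (⨂ B_{n₁n₃}) ⊗ (⨂ C_{n₁n₂}) ⊗ (⨂ D_{n₀n₃}) ⊗ (⨂ E_{n₀n₂}) ⊗ (⨂ F_{n₀n₁})`. -/
abbrev BoxIndex (N₀ N₁ N₂ N₃ : ℕ) : Type :=
  (Fin N₂ × Fin N₃) ⊕ ((Fin N₁ × Fin N₃) ⊕ ((Fin N₁ × Fin N₂) ⊕
    ((Fin N₀ × Fin N₃) ⊕ ((Fin N₀ × Fin N₂) ⊕ (Fin N₀ × Fin N₁)))))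

/-- Label of the factor `A_{n₂ n₃}`. -/
abbrev iA {N₀ N₁ N₂ N₃ : ℕ} (n₂ : Fin N₂) (n₃ : Fin N₃) : BoxIndex N₀ N₁ N₂ N₃ :=
  Sum.inl (n₂, n₃)
/-- Label of the factor `B_{n₁ n₃}`. -/
abbrev iB {N₀ N₁ N₂ N₃ : ℕ} (n₁ : Fin N₁) (n₃ : Fin N₃) : BoxIndex N₀ N₁ N₂ N₃ :=
  Sum.inr (Sum.inl (n₁, n₃))
/-- Label of the factor `C_{n₁ n₂}`. -/
abbrev iC {N₀ N₁ N₂ N₃ : ℕ} (n₁ : Fin N₁) (n₂ : Fin N₂) : BoxIndex N₀ N₁ N₂ N₃ :=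
  Sum.inr (Sum.inr (Sum.inl (n₁, n₂)))
/-- Label of the factor `D_{n₀ n₃}`. -/
abbrev iD {N₀ N₁ N₂ N₃ : ℕ} (n₀ : Fin N₀) (n₃ : Fin N₃) : BoxIndex N₀ N₁ N₂ N₃ :=
  Sum.inr (Sum.inr (Sum.inr (Sum.inl (n₀, n₃))))
/-- Label of the factor `E_{n₀ n₂}`. -/
abbrev iE {N₀ N₁ N₂ N₃ : ℕ} (n₀ : Fin N₀) (n₂ : Fin N₂) : BoxIndex N₀ N₁ N₂ N₃ :=
  Sum.inr (Sum.inr (Sum.inr (Sum.inr (Sum.inl (n₀, n₂)))))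
/-- Label of the factor `F_{n₀ n₁}`. -/
abbrev iF {N₀ N₁ N₂ N₃ : ℕ} (n₀ : Fin N₀) (n₁ : Fin N₁) : BoxIndex N₀ N₁ N₂ N₃ :=
  Sum.inr (Sum.inr (Sum.inr (Sum.inr (Sum.inr (n₀, n₁)))))

namespace ActsAsIdOutside

variable {ι : Type*} [Fintype ι] [DecidableEq ι] {I : ι → Type*} [∀ k, Fintype (I k)]
  [∀ k, DecidableEq (I k)]

/-- Operators acting on disjoint sets of tensor factors commute. -/
theorem commute_s10 {S T : Finset ι} (hST : Disjoint S T) {M N : Matrix (∀ k, I k) (∀ k, I k) ℂ}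
    (hM : ActsAsIdOutside S M) (hN : ActsAsIdOutside T N) : Commute M N := by
  have mul_apply : ∀ {S T : Finset ι}, Disjoint S T →
      ∀ {M N : Matrix (∀ k, I k) (∀ k, I k) ℂ} {A : ((k : S) → I k.1) → ((k : S) → I k.1) → ℂ}
        {B : ((k : T) → I k.1) → ((k : T) → I k.1) → ℂ},
      (∀ p q, M p q = A (fun k => p k.1) (fun k => q k.1) *
        (if ∀ k ∉ S, p k = q k then 1 else 0)) →
      (∀ p q, N p q = B (fun k => p k.1) (fun k => q k.1) *
        (if ∀ k ∉ T, p k = q k then 1 else 0)) →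
      ∀ p r, (M * N) p r = A (fun k => p k.1) (fun k => r k.1) *
        B (fun k => p k.1) (fun k => r k.1) * (if ∀ k ∉ S ∪ T, p k = r k then 1 else 0) := by
    intro S T hST M N A B hM hN p r
    have hT : ∀ k ∈ T, k ∉ S := fun k hk hk' => Finset.disjoint_left.1 hST hk' hk
    rw [Matrix.mul_apply, Finset.sum_eq_single (S.piecewise r p)]
    · have h₁ : (fun k : S => S.piecewise r p k.1) = fun k : S => r k.1 := by
        funext k; simp
      have h₂ : (fun k : T => S.piecewise r p k.1) = fun k : T => p k.1 := by
        funext k; simp [hT k.1 k.2]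
      have h₃ : ∀ k ∉ S, p k = S.piecewise r p k := fun k hk => by simp [hk]
      have h₄ : (∀ k ∉ T, S.piecewise r p k = r k) ↔ ∀ k ∉ S ∪ T, p k = r k := by
        refine ⟨fun h k hk => ?_, fun h k hk => ?_⟩
        · rw [Finset.mem_union, not_or] at hk
          simpa [hk.1] using h k hk.2
        · by_cases hS : k ∈ S
          · simp [hS]
          · simpa [hS] using h k (by simp [hS, hk])
      rw [hM, hN, h₁, h₂, if_pos h₃]
      simp only [h₄, mul_one, mul_assoc]
    · intro q _ hq
      rw [hM, hN]
      by_cases h₁ : ∀ k ∉ S, p k = q k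
      · have h₂ : ¬ ∀ k ∉ T, q k = r k := by
          refine fun h₂ => hq (funext fun k => ?_)
          by_cases hS : k ∈ S
          · simpa [hS] using h₂ k (Finset.disjoint_left.1 hST hS)
          · simpa [hS] using (h₁ k hS).symm
        rw [if_neg h₂, mul_zero, mul_zero]
      · rw [if_neg h₁, mul_zero, zero_mul]
    · simp
  obtain ⟨A, hA⟩ := hM
  obtain ⟨B, hB⟩ := hN
  ext p r
  rw [mul_apply hST hA hB, mul_apply hST.symm hB hA, Finset.union_comm,
    mul_comm (A _ _) (B _ _)]

end ActsAsIdOutside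

section OrderedProducts

variable {G A : Type*} [AddCommMonoid G] [Monoid A]

/-- The product of the `R i`, in ascending order of `i`, the argument of `R i` being shifted by
the sum of the `s j` with `j < i`. -/
def ascProd {N : ℕ} (s : Fin N → G) (R : Fin N → G → A) (v : G) : A :=
  ((List.finRange N).map fun i => R i (v + ∑ j ∈ Finset.Iio i, s j)).prod

/-- The product of the `R i`, in descending order of `i`, the argument of `R i` being shifted by
the sum of the `s j` with `j < i`. -/
def descProd {N : ℕ} (s : Fin N → G) (R : Fin N → G → A) (v : G) : A :=
  ((List.finRange N).reverse.map fun i => R i (v + ∑ j ∈ Finset.Iio i, s j)).prod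

@[simp]
theorem ascProd_zero (s : Fin 0 → G) (R : Fin 0 → G → A) (v : G) : ascProd s R v = 1 := by
  simp [ascProd]

@[simp]
theorem descProd_zero (s : Fin 0 → G) (R : Fin 0 → G → A) (v : G) : descProd s R v = 1 := by
  simp [descProd]

theorem sum_Iio_fin_succ {N : ℕ} (s : Fin (N + 1) → G) (i : Fin N) :
    ∑ j ∈ Finset.Iio i.succ, s j = s 0 + ∑ j ∈ Finset.Iio i, s j.succ := by
  have h : Finset.Iio i.succ = Finset.cons 0 ((Finset.Iio i).map (Fin.succEmb N)) (by simp) := by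
    ext j
    refine Fin.cases ?_ (fun j => ?_) j <;> simp
  rw [h, Finset.sum_cons, Finset.sum_map]
  rfl

theorem ascProd_succ {N : ℕ} (s : Fin (N + 1) → G) (R : Fin (N + 1) → G → A) (v : G) :
    ascProd s R v = R 0 v * ascProd (fun i => s i.succ) (fun i => R i.succ) (v + s 0) := by
  have h : Finset.Iio (0 : Fin (N + 1)) = ∅ := by ext; simp
  simp [ascProd, List.finRange_succ, Function.comp_def, sum_Iio_fin_succ, add_assoc, h]

theorem descProd_succ {N : ℕ} (s : Fin (N + 1) → G) (R : Fin (N + 1) → G → A) (v : G) :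
    descProd s R v = descProd (fun i => s i.succ) (fun i => R i.succ) (v + s 0) * R 0 v := by
  have h : Finset.Iio (0 : Fin (N + 1)) = ∅ := by ext; simp
  simp [descProd, List.finRange_succ, Function.comp_def, sum_Iio_fin_succ, add_assoc, h]

theorem Commute.ascProd_right {N : ℕ} {a : A} {s : Fin N → G} {R : Fin N → G → A}
    (h : ∀ i w, Commute a (R i w)) (v : G) : Commute a (ascProd s R v) :=
  Commute.list_prod_right _ _ <| by
    simp only [List.mem_map]
    rintro _ ⟨i, -, rfl⟩
    exact h _ _

theorem Commute.descProd_right {N : ℕ} {a : A} {s : Fin N → G} {R : Fin N → G → A}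
    (h : ∀ i w, Commute a (R i w)) (v : G) : Commute a (descProd s R v) :=
  Commute.list_prod_right _ _ <| by
    simp only [List.mem_map]
    rintro _ ⟨i, -, rfl⟩
    exact h _ _

theorem Commute.ascProd_left {N : ℕ} {a : A} {s : Fin N → G} {R : Fin N → G → A}
    (h : ∀ i w, Commute (R i w) a) (v : G) : Commute (ascProd s R v) a :=
  (Commute.ascProd_right (fun i w => (h i w).symm) v).symm

theorem Commute.descProd_left {N : ℕ} {a : A} {s : Fin N → G} {R : Fin N → G → A}
    (h : ∀ i w, Commute (R i w) a) (v : G) : Commute (descProd s R v) a :=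
  (Commute.descProd_right (fun i w => (h i w).symm) v).symm

end OrderedProducts

section Fusion

/-- Operators labelled by different values of a common index commute. -/
def CrossCommute {ι G A : Type*} [Mul A] (P Q : ι → G → A) : Prop :=
  ∀ i j, i ≠ j → ∀ v w, Commute (P i v) (Q j w)

namespace CrossCommute

variable {G A : Type*} [Mul A] {N : ℕ} {P Q : Fin (N + 1) → G → A}

theorem succ (h : CrossCommute P Q) :
    CrossCommute (fun i : Fin N => P i.succ) (fun i : Fin N => Q i.succ) :=
  fun i j hij => h _ _ (by simpa using hij)

theorem zero_succ (h : CrossCommute P Q) (i : Fin N) (v w : G) :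
    Commute (P 0 v) (Q i.succ w) :=
  h _ _ (Fin.succ_ne_zero i).symm v w

theorem succ_zero (h : CrossCommute P Q) (i : Fin N) (v w : G) :
    Commute (P i.succ v) (Q 0 w) :=
  h _ _ (Fin.succ_ne_zero i) v w

end CrossCommute

variable {K G A : Type*} [CommSemiring K] [AddCommMonoid G] [Semiring A] [Algebra K A]

/-- The modified tetrahedron equation with shifts `u`, `x`, `y`, `z` and scalar factor `ρ`, for
operators `P`, `Q`, `S`, `T` in the roles of `XYZ`, `UYZ`, `UXZ`, `UXY`. -/
def ModifiedTetrahedron (ρ : K) (u x y z : G) (P Q S T : G → A) : Prop :=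
  ∀ v, P v * Q (v + x) * S v * T (v + z) = ρ • (T v * S (v + y) * Q v * P (v + u))

namespace ModifiedTetrahedron

/-- Fusion in the direction of `z`, the last factor `T` being common to all layers. -/
theorem fuse_z {N : ℕ} {ρ : Fin N → K} {u x y : G} {z : Fin N → G} {P Q S : Fin N → G → A}
    {T : G → A} (hPQ : CrossCommute P Q) (hPS : CrossCommute P S) (hQS : CrossCommute Q S)
    (h : ∀ i, ModifiedTetrahedron (ρ i) u x y (z i) (P i) (Q i) (S i) T) :
    ModifiedTetrahedron (∏ i, ρ i) u x y (∑ i, z i) (ascProd z P) (ascProd z Q) (ascProd z S)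
      T := by
  have step : ∀ {r r' : K} {p p' q q' s s' t t₁ t₂ P₀ P₁ Q₀ Q₁ S₀ S₁ : A},
      p * q * s * t₁ = r • (t₂ * S₀ * Q₀ * P₀) → p' * q' * s' * t = r' • (t₁ * S₁ * Q₁ * P₁) →
      Commute p' q → Commute p' s → Commute q' s →
      Commute P₀ Q₁ → Commute P₀ S₁ → Commute Q₀ S₁ →
      p * p' * (q * q') * (s * s') * t =
        (r * r') • (t₂ * (S₀ * S₁) * (Q₀ * Q₁) * (P₀ * P₁)) := by
    intro r r' p p' q q' s s' t t₁ t₂ P₀ P₁ Q₀ Q₁ S₀ S₁ h₀ h₁ c₁ c₂ c₃ c₄ c₅ c₆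
    calc p * p' * (q * q') * (s * s') * t = p * q * s * (p' * q' * s' * t) := by
          simp only [mul_assoc, c₁.left_comm, c₂.left_comm, c₃.left_comm]
      _ = r' • (p * q * s * t₁ * (S₁ * Q₁ * P₁)) := by
          rw [h₁, mul_smul_comm]; simp only [mul_assoc]
      _ = _ := by
          rw [h₀, smul_mul_assoc, smul_smul, mul_comm r']
          simp only [mul_assoc, c₄.left_comm, c₅.left_comm, c₆.left_comm]
  induction N with
  | zero => intro v; simp
  | succ N ih =>
    intro v
    have ih := ih hPQ.succ hPS.succ hQS.succ (fun i => h i.succ) (v + z 0)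
    simp only [ascProd_succ, Fin.sum_univ_succ, Fin.prod_univ_succ, ← add_assoc]
    rw [add_right_comm v x, add_right_comm v y, add_right_comm v u]
    exact step (h 0 v) ih
      (Commute.ascProd_left (fun i w => hPQ.succ_zero i w _) _)
      (Commute.ascProd_left (fun i w => hPS.succ_zero i w _) _)
      (Commute.ascProd_left (fun i w => hQS.succ_zero i w _) _)
      (Commute.ascProd_right (fun i w => hPQ.zero_succ i _ w) _)
      (Commute.ascProd_right (fun i w => hPS.zero_succ i _ w) _)
      (Commute.ascProd_right (fun i w => hQS.zero_succ i _ w) _)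

/-- Fusion in the direction of `y`, the third factor `S` being common to all layers. -/
theorem fuse_y {N : ℕ} {ρ : Fin N → K} {u x z : G} {y : Fin N → G} {P Q T : Fin N → G → A}
    {S : G → A} (hPQ : CrossCommute P Q) (hPT : CrossCommute P T) (hQT : CrossCommute Q T)
    (h : ∀ i, ModifiedTetrahedron (ρ i) u x (y i) z (P i) (Q i) S (T i)) :
    ModifiedTetrahedron (∏ i, ρ i) u x (∑ i, y i) z (descProd y P) (descProd y Q) S
      (ascProd y T) := by
  have step : ∀ {r r' : K} {p p' q q' s s₁ s₂ t t' P₀ P₁ Q₀ Q₁ T₀ T₁ : A},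
      p * q * s * t = r • (T₀ * s₁ * Q₀ * P₀) → p' * q' * s₁ * t' = r' • (T₁ * s₂ * Q₁ * P₁) →
      Commute p q' → Commute p' T₀ → Commute q' T₀ →
      Commute Q₀ t' → Commute P₀ t' → Commute P₁ Q₀ →
      p' * p * (q' * q) * s * (t * t') =
        (r * r') • (T₀ * T₁ * s₂ * (Q₁ * Q₀) * (P₁ * P₀)) := by
    intro r r' p p' q q' s s₁ s₂ t t' P₀ P₁ Q₀ Q₁ T₀ T₁ h₀ h₁ c₁ c₂ c₃ c₄ c₅ c₆
    calc p' * p * (q' * q) * s * (t * t') = p' * q' * (p * q * s * t) * t' := by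
          simp only [mul_assoc, c₁.left_comm]
      _ = r • (T₀ * (p' * q' * s₁ * t') * (Q₀ * P₀)) := by
          rw [h₀, mul_smul_comm, smul_mul_assoc]
          simp only [mul_assoc, c₂.left_comm, c₃.left_comm, c₅.eq, c₄.left_comm]
      _ = _ := by
          rw [h₁, mul_smul_comm, smul_mul_assoc, smul_smul]
          simp only [mul_assoc, c₆.left_comm]
  induction N with
  | zero => intro v; simp
  | succ N ih =>
    intro v
    have ih := ih hPQ.succ hPT.succ hQT.succ (fun i => h i.succ) (v + y 0)
    simp only [ascProd_succ, descProd_succ, Fin.sum_univ_succ, Fin.prod_univ_succ, ← add_assoc]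
    rw [add_right_comm v x, add_right_comm v z, add_right_comm v u]
    exact step (h 0 v) ih
      (Commute.descProd_right (fun i w => hPQ.zero_succ i _ w) _)
      (Commute.descProd_left (fun i w => hPT.succ_zero i w _) _)
      (Commute.descProd_left (fun i w => hQT.succ_zero i w _) _)
      (Commute.ascProd_right (fun i w => hQT.zero_succ i _ w) _)
      (Commute.ascProd_right (fun i w => hPT.zero_succ i _ w) _)
      (Commute.descProd_left (fun i w => hPQ.succ_zero i w _) _)

/-- Fusion in the direction of `x`, the second factor `Q` being common to all layers. -/
theorem fuse_x {N : ℕ} {ρ : Fin N → K} {u y z : G} {x : Fin N → G} {P S T : Fin N → G → A}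
    {Q : G → A} (hPS : CrossCommute P S) (hPT : CrossCommute P T) (hST : CrossCommute S T)
    (h : ∀ i, ModifiedTetrahedron (ρ i) u (x i) y z (P i) Q (S i) (T i)) :
    ModifiedTetrahedron (∏ i, ρ i) u (∑ i, x i) y z (ascProd x P) Q (descProd x S)
      (descProd x T) := by
  have step : ∀ {r r' : K} {p p' q q₁ q₂ s s' t t' P₀ P₁ S₀ S₁ T₀ T₁ : A},
      p * q₁ * s * t = r • (T₀ * S₀ * q₂ * P₀) → p' * q * s' * t' = r' • (T₁ * S₁ * q₁ * P₁) →
      Commute s t' → Commute P₁ s → Commute P₁ t →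
      Commute p T₁ → Commute p S₁ → Commute S₁ T₀ →
      p * p' * q * (s' * s) * (t' * t) =
        (r * r') • (T₁ * T₀ * (S₁ * S₀) * q₂ * (P₀ * P₁)) := by
    intro r r' p p' q q₁ q₂ s s' t t' P₀ P₁ S₀ S₁ T₀ T₁ h₀ h₁ c₁ c₂ c₃ c₄ c₅ c₆
    calc p * p' * q * (s' * s) * (t' * t) = p * (p' * q * s' * t') * (s * t) := by
          simp only [mul_assoc, c₁.left_comm]
      _ = r' • (T₁ * S₁ * (p * q₁ * s * t) * P₁) := by
          rw [h₁, mul_smul_comm, smul_mul_assoc]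
          simp only [mul_assoc, c₂.left_comm, c₃.eq, c₄.left_comm, c₅.left_comm]
      _ = _ := by
          rw [h₀, mul_smul_comm, smul_mul_assoc, smul_smul, mul_comm r']
          simp only [mul_assoc, c₆.left_comm]
  induction N with
  | zero => intro v; simp
  | succ N ih =>
    intro v
    have ih := ih hPS.succ hPT.succ hST.succ (fun i => h i.succ) (v + x 0)
    simp only [ascProd_succ, descProd_succ, Fin.sum_univ_succ, Fin.prod_univ_succ, ← add_assoc]
    rw [add_right_comm v y, add_right_comm v z, add_right_comm v u]
    exact step (h 0 v) ih
      (Commute.descProd_right (fun i w => hST.zero_succ i _ w) _)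
      (Commute.ascProd_left (fun i w => hPS.succ_zero i w _) _)
      (Commute.ascProd_left (fun i w => hPT.succ_zero i w _) _)
      (Commute.descProd_right (fun i w => hPT.zero_succ i _ w) _)
      (Commute.descProd_right (fun i w => hPS.zero_succ i _ w) _)
      (Commute.descProd_left (fun i w => hST.succ_zero i w _) _)

/-- Fusion in the direction of `u`, the first factor `P` being common to all layers. -/
theorem fuse_u {N : ℕ} {ρ : Fin N → K} {x y z : G} {u : Fin N → G} {Q S T : Fin N → G → A}
    {P : G → A} (hQS : CrossCommute Q S) (hQT : CrossCommute Q T) (hST : CrossCommute S T)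
    (h : ∀ i, ModifiedTetrahedron (ρ i) (u i) x y z P (Q i) (S i) (T i)) :
    ModifiedTetrahedron (∏ i, ρ i) (∑ i, u i) x y z P (ascProd u Q) (ascProd u S)
      (ascProd u T) := by
  have step : ∀ {r r' : K} {p p₁ p₂ q q' s s' t t' Q₀ Q₁ S₀ S₁ T₀ T₁ : A},
      p * q * s * t = r • (T₀ * S₀ * Q₀ * p₁) → p₁ * q' * s' * t' = r' • (T₁ * S₁ * Q₁ * p₂) →
      Commute q' s → Commute q' t → Commute s' t →
      Commute Q₀ S₁ → Commute Q₀ T₁ → Commute S₀ T₁ →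
      p * (q * q') * (s * s') * (t * t') =
        (r * r') • (T₀ * T₁ * (S₀ * S₁) * (Q₀ * Q₁) * p₂) := by
    intro r r' p p₁ p₂ q q' s s' t t' Q₀ Q₁ S₀ S₁ T₀ T₁ h₀ h₁ c₁ c₂ c₃ c₄ c₅ c₆
    calc p * (q * q') * (s * s') * (t * t') = p * q * s * t * (q' * s' * t') := by
          simp only [mul_assoc, c₁.left_comm, c₂.left_comm, c₃.left_comm]
      _ = r • (T₀ * S₀ * Q₀ * (p₁ * q' * s' * t')) := by
          rw [h₀, smul_mul_assoc]; simp only [mul_assoc]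
      _ = _ := by
          rw [h₁, mul_smul_comm, smul_smul]
          simp only [mul_assoc, c₄.left_comm, c₅.left_comm, c₆.left_comm]
  induction N with
  | zero => intro v; simp
  | succ N ih =>
    intro v
    have ih := ih hQS.succ hQT.succ hST.succ (fun i => h i.succ) (v + u 0)
    simp only [ascProd_succ, Fin.sum_univ_succ, Fin.prod_univ_succ, ← add_assoc]
    rw [add_right_comm v x, add_right_comm v y, add_right_comm v z]
    exact step (h 0 v) ih
      (Commute.ascProd_left (fun i w => hQS.succ_zero i w _) _)
      (Commute.ascProd_left (fun i w => hQT.succ_zero i w _) _)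
      (Commute.ascProd_left (fun i w => hST.succ_zero i w _) _)
      (Commute.ascProd_right (fun i w => hQS.zero_succ i _ w) _)
      (Commute.ascProd_right (fun i w => hQT.zero_succ i _ w) _)
      (Commute.ascProd_right (fun i w => hST.zero_succ i _ w) _)

/-- The fused modified tetrahedron equation: the box products of local operators satisfying the
modified tetrahedron equation satisfy it with the total shifts. -/
theorem fuse {N₀ N₁ N₂ N₃ : ℕ} {u : Fin N₀ → G} {x : Fin N₁ → G} {y : Fin N₂ → G}
    {z : Fin N₃ → G} {ρ : Fin N₀ → Fin N₁ → Fin N₂ → Fin N₃ → K}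
    {P : Fin N₁ → Fin N₂ → Fin N₃ → G → A} {Q : Fin N₀ → Fin N₂ → Fin N₃ → G → A}
    {S : Fin N₀ → Fin N₁ → Fin N₃ → G → A} {T : Fin N₀ → Fin N₁ → Fin N₂ → G → A}
    (hPQ : ∀ n₁ n₂ n₃ v n₀ m₂ m₃ w, n₂ ≠ m₂ ∨ n₃ ≠ m₃ → Commute (P n₁ n₂ n₃ v) (Q n₀ m₂ m₃ w))
    (hPS : ∀ n₁ n₂ n₃ v n₀ m₁ m₃ w, n₁ ≠ m₁ ∨ n₃ ≠ m₃ → Commute (P n₁ n₂ n₃ v) (S n₀ m₁ m₃ w))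
    (hPT : ∀ n₁ n₂ n₃ v n₀ m₁ m₂ w, n₁ ≠ m₁ ∨ n₂ ≠ m₂ → Commute (P n₁ n₂ n₃ v) (T n₀ m₁ m₂ w))
    (hQS : ∀ n₀ n₂ n₃ v m₀ m₁ m₃ w, n₀ ≠ m₀ ∨ n₃ ≠ m₃ → Commute (Q n₀ n₂ n₃ v) (S m₀ m₁ m₃ w))
    (hQT : ∀ n₀ n₂ n₃ v m₀ m₁ m₂ w, n₀ ≠ m₀ ∨ n₂ ≠ m₂ → Commute (Q n₀ n₂ n₃ v) (T m₀ m₁ m₂ w))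
    (hST : ∀ n₀ n₁ n₃ v m₀ m₁ m₂ w, n₀ ≠ m₀ ∨ n₁ ≠ m₁ → Commute (S n₀ n₁ n₃ v) (T m₀ m₁ m₂ w))
    (h : ∀ n₀ n₁ n₂ n₃, ModifiedTetrahedron (ρ n₀ n₁ n₂ n₃) (u n₀) (x n₁) (y n₂) (z n₃)
      (P n₁ n₂ n₃) (Q n₀ n₂ n₃) (S n₀ n₁ n₃) (T n₀ n₁ n₂)) :
    ModifiedTetrahedron (∏ n₀, ∏ n₁, ∏ n₂, ∏ n₃, ρ n₀ n₁ n₂ n₃) (∑ n₀, u n₀) (∑ n₁, x n₁)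
      (∑ n₂, y n₂) (∑ n₃, z n₃)
      (ascProd x fun n₁ => descProd y fun n₂ => ascProd z (P n₁ n₂))
      (ascProd u fun n₀ => descProd y fun n₂ => ascProd z (Q n₀ n₂))
      (ascProd u fun n₀ => descProd x fun n₁ => ascProd z (S n₀ n₁))
      (ascProd u fun n₀ => descProd x fun n₁ => ascProd y (T n₀ n₁)) := by
  have fused_z : ∀ n₀ n₁ n₂, ModifiedTetrahedron (∏ n₃, ρ n₀ n₁ n₂ n₃) (u n₀) (x n₁) (y n₂)
      (∑ n₃, z n₃) (ascProd z (P n₁ n₂)) (ascProd z (Q n₀ n₂)) (ascProd z (S n₀ n₁))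
      (T n₀ n₁ n₂) := fun n₀ n₁ n₂ =>
    .fuse_z (fun _ _ hne _ _ => hPQ _ _ _ _ _ _ _ _ (.inr hne))
      (fun _ _ hne _ _ => hPS _ _ _ _ _ _ _ _ (.inr hne))
      (fun _ _ hne _ _ => hQS _ _ _ _ _ _ _ _ (.inr hne)) (fun n₃ => h n₀ n₁ n₂ n₃)
  have fused_yz : ∀ n₀ n₁, ModifiedTetrahedron (∏ n₂, ∏ n₃, ρ n₀ n₁ n₂ n₃) (u n₀) (x n₁)
      (∑ n₂, y n₂) (∑ n₃, z n₃) (descProd y fun n₂ => ascProd z (P n₁ n₂))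
      (descProd y fun n₂ => ascProd z (Q n₀ n₂)) (ascProd z (S n₀ n₁))
      (ascProd y (T n₀ n₁)) := fun n₀ n₁ =>
    .fuse_y
      (fun _ _ hne _ _ => .ascProd_left (fun _ _ => .ascProd_right (fun _ _ =>
        hPQ _ _ _ _ _ _ _ _ (.inl hne)) _) _)
      (fun _ _ hne _ _ => .ascProd_left (fun _ _ => hPT _ _ _ _ _ _ _ _ (.inr hne)) _)
      (fun _ _ hne _ _ => .ascProd_left (fun _ _ => hQT _ _ _ _ _ _ _ _ (.inr hne)) _)
      (fused_z n₀ n₁)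
  have fused_xyz : ∀ n₀, ModifiedTetrahedron (∏ n₁, ∏ n₂, ∏ n₃, ρ n₀ n₁ n₂ n₃) (u n₀)
      (∑ n₁, x n₁) (∑ n₂, y n₂) (∑ n₃, z n₃)
      (ascProd x fun n₁ => descProd y fun n₂ => ascProd z (P n₁ n₂))
      (descProd y fun n₂ => ascProd z (Q n₀ n₂))
      (descProd x fun n₁ => ascProd z (S n₀ n₁))
      (descProd x fun n₁ => ascProd y (T n₀ n₁)) := fun n₀ =>
    .fuse_x
      (fun _ _ hne _ _ => .descProd_left (fun _ _ => .ascProd_left (fun _ _ =>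
        .ascProd_right (fun _ _ => hPS _ _ _ _ _ _ _ _ (.inl hne)) _) _) _)
      (fun _ _ hne _ _ => .descProd_left (fun _ _ => .ascProd_left (fun _ _ =>
        .ascProd_right (fun _ _ => hPT _ _ _ _ _ _ _ _ (.inl hne)) _) _) _)
      (fun _ _ hne _ _ => .ascProd_left (fun _ _ =>
        .ascProd_right (fun _ _ => hST _ _ _ _ _ _ _ _ (.inr hne)) _) _)
      (fused_yz n₀)
  exact .fuse_u
      (fun _ _ hne _ _ => .descProd_left (fun _ _ => .ascProd_left (fun _ _ =>
        .descProd_right (fun _ _ => .ascProd_right (fun _ _ =>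
          hQS _ _ _ _ _ _ _ _ (.inl hne)) _) _) _) _)
      (fun _ _ hne _ _ => .descProd_left (fun _ _ => .ascProd_left (fun _ _ =>
        .descProd_right (fun _ _ => .ascProd_right (fun _ _ =>
          hQT _ _ _ _ _ _ _ _ (.inl hne)) _) _) _) _)
      (fun _ _ hne _ _ => .descProd_left (fun _ _ => .ascProd_left (fun _ _ =>
        .descProd_right (fun _ _ => .ascProd_right (fun _ _ =>
          hST _ _ _ _ _ _ _ _ (.inl hne)) _) _) _) _)
      fused_xyz

end ModifiedTetrahedron

end Fusion

/-- Tetrahedron equation for fused box weights when the total shifts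
vanish (abstract form of Theorem 3 of the paper): in the setting of the fused modified
tetrahedron equation, if moreover `Σ u = Σ x = Σ y = Σ z = 0` in `G` and
`∏ ρ_{n₀n₁n₂n₃} = 1`, then the fused box weights satisfy the ordinary tetrahedron
equation. -/
theorem fused_box_te_of_shifts_vanish (N₀ N₁ N₂ N₃ : ℕ)
    (hN₀ : 0 < N₀) (hN₁ : 0 < N₁) (hN₂ : 0 < N₂) (hN₃ : 0 < N₃)
    {G : Type*} [AddCommGroup G]
    (u : Fin N₀ → G) (x : Fin N₁ → G) (y : Fin N₂ → G) (z : Fin N₃ → G)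
    {I : BoxIndex N₀ N₁ N₂ N₃ → Type*} [∀ k, Fintype (I k)] [∀ k, DecidableEq (I k)]
    (RXYZ : Fin N₁ → Fin N₂ → Fin N₃ → G → Matrix (∀ k, I k) (∀ k, I k) ℂ)
    (RUYZ : Fin N₀ → Fin N₂ → Fin N₃ → G → Matrix (∀ k, I k) (∀ k, I k) ℂ)
    (RUXZ : Fin N₀ → Fin N₁ → Fin N₃ → G → Matrix (∀ k, I k) (∀ k, I k) ℂ)
    (RUXY : Fin N₀ → Fin N₁ → Fin N₂ → G → Matrix (∀ k, I k) (∀ k, I k) ℂ)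
    (ρ : Fin N₀ → Fin N₁ → Fin N₂ → Fin N₃ → ℂ)
    (hXYZsupp : ∀ n₁ n₂ n₃ v,
      ActsAsIdOutside {iA n₂ n₃, iB n₁ n₃, iC n₁ n₂} (RXYZ n₁ n₂ n₃ v))
    (hUYZsupp : ∀ n₀ n₂ n₃ v,
      ActsAsIdOutside {iA n₂ n₃, iD n₀ n₃, iE n₀ n₂} (RUYZ n₀ n₂ n₃ v))
    (hUXZsupp : ∀ n₀ n₁ n₃ v,
      ActsAsIdOutside {iB n₁ n₃, iD n₀ n₃, iF n₀ n₁} (RUXZ n₀ n₁ n₃ v))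
    (hUXYsupp : ∀ n₀ n₁ n₂ v,
      ActsAsIdOutside {iC n₁ n₂, iE n₀ n₂, iF n₀ n₁} (RUXY n₀ n₁ n₂ v))
    (hMTE : ∀ n₀ n₁ n₂ n₃, ∀ v : G,
      RXYZ n₁ n₂ n₃ v * RUYZ n₀ n₂ n₃ (v + x n₁) * RUXZ n₀ n₁ n₃ v *
          RUXY n₀ n₁ n₂ (v + z n₃) =
        ρ n₀ n₁ n₂ n₃ • (RUXY n₀ n₁ n₂ v * RUXZ n₀ n₁ n₃ (v + y n₂) *
          RUYZ n₀ n₂ n₃ v * RXYZ n₁ n₂ n₃ (v + u n₀)))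
    (hIU : ∑ n₀, u n₀ = 0) (hIX : ∑ n₁, x n₁ = 0)
    (hIY : ∑ n₂, y n₂ = 0) (hIZ : ∑ n₃, z n₃ = 0)
    (hρ : ∏ n₀, ∏ n₁, ∏ n₂, ∏ n₃, ρ n₀ n₁ n₂ n₃ = 1)
    (RfXYZ RfUYZ RfUXZ RfUXY : G → Matrix (∀ k, I k) (∀ k, I k) ℂ)
    (hRfXYZ : ∀ v, RfXYZ v =
      ((List.finRange N₁).map (fun n₁ =>
        (((List.finRange N₂).reverse).map (fun n₂ =>
          ((List.finRange N₃).map (fun n₃ =>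
            RXYZ n₁ n₂ n₃ (v + ∑ m₁ ∈ Finset.Iio n₁, x m₁ +
              ∑ m₂ ∈ Finset.Iio n₂, y m₂ + ∑ m₃ ∈ Finset.Iio n₃, z m₃))).prod)).prod)).prod)
    (hRfUYZ : ∀ v, RfUYZ v =
      ((List.finRange N₀).map (fun n₀ =>
        (((List.finRange N₂).reverse).map (fun n₂ =>
          ((List.finRange N₃).map (fun n₃ =>
            RUYZ n₀ n₂ n₃ (v + ∑ m₀ ∈ Finset.Iio n₀, u m₀ +
              ∑ m₂ ∈ Finset.Iio n₂, y m₂ + ∑ m₃ ∈ Finset.Iio n₃, z m₃))).prod)).prod)).prod)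
    (hRfUXZ : ∀ v, RfUXZ v =
      ((List.finRange N₀).map (fun n₀ =>
        (((List.finRange N₁).reverse).map (fun n₁ =>
          ((List.finRange N₃).map (fun n₃ =>
            RUXZ n₀ n₁ n₃ (v + ∑ m₀ ∈ Finset.Iio n₀, u m₀ +
              ∑ m₁ ∈ Finset.Iio n₁, x m₁ + ∑ m₃ ∈ Finset.Iio n₃, z m₃))).prod)).prod)).prod)
    (hRfUXY : ∀ v, RfUXY v =
      ((List.finRange N₀).map (fun n₀ =>
        (((List.finRange N₁).reverse).map (fun n₁ =>
          ((List.finRange N₂).map (fun n₂ =>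
            RUXY n₀ n₁ n₂ (v + ∑ m₀ ∈ Finset.Iio n₀, u m₀ +
              ∑ m₁ ∈ Finset.Iio n₁, x m₁ + ∑ m₂ ∈ Finset.Iio n₂, y m₂))).prod)).prod)).prod) :
    ∀ v : G,
      RfXYZ v * RfUYZ v * RfUXZ v * RfUXY v =
        RfUXY v * RfUXZ v * RfUYZ v * RfXYZ v := by
  have hPQ : ∀ n₁ n₂ n₃ v n₀ m₂ m₃ w, n₂ ≠ m₂ ∨ n₃ ≠ m₃ →
      Commute (RXYZ n₁ n₂ n₃ v) (RUYZ n₀ m₂ m₃ w) := fun n₁ n₂ n₃ v n₀ m₂ m₃ w h =>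
    (hXYZsupp n₁ n₂ n₃ v).commute_s10 (by simp; tauto) (hUYZsupp n₀ m₂ m₃ w)
  have hPS : ∀ n₁ n₂ n₃ v n₀ m₁ m₃ w, n₁ ≠ m₁ ∨ n₃ ≠ m₃ →
      Commute (RXYZ n₁ n₂ n₃ v) (RUXZ n₀ m₁ m₃ w) := fun n₁ n₂ n₃ v n₀ m₁ m₃ w h =>
    (hXYZsupp n₁ n₂ n₃ v).commute_s10 (by simp; tauto) (hUXZsupp n₀ m₁ m₃ w)
  have hPT : ∀ n₁ n₂ n₃ v n₀ m₁ m₂ w, n₁ ≠ m₁ ∨ n₂ ≠ m₂ →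
      Commute (RXYZ n₁ n₂ n₃ v) (RUXY n₀ m₁ m₂ w) := fun n₁ n₂ n₃ v n₀ m₁ m₂ w h =>
    (hXYZsupp n₁ n₂ n₃ v).commute_s10 (by simp; tauto) (hUXYsupp n₀ m₁ m₂ w)
  have hQS : ∀ n₀ n₂ n₃ v m₀ m₁ m₃ w, n₀ ≠ m₀ ∨ n₃ ≠ m₃ →
      Commute (RUYZ n₀ n₂ n₃ v) (RUXZ m₀ m₁ m₃ w) := fun n₀ n₂ n₃ v m₀ m₁ m₃ w h =>
    (hUYZsupp n₀ n₂ n₃ v).commute_s10 (by simp; tauto) (hUXZsupp m₀ m₁ m₃ w)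
  have hQT : ∀ n₀ n₂ n₃ v m₀ m₁ m₂ w, n₀ ≠ m₀ ∨ n₂ ≠ m₂ →
      Commute (RUYZ n₀ n₂ n₃ v) (RUXY m₀ m₁ m₂ w) := fun n₀ n₂ n₃ v m₀ m₁ m₂ w h =>
    (hUYZsupp n₀ n₂ n₃ v).commute_s10 (by simp; tauto) (hUXYsupp m₀ m₁ m₂ w)
  have hST : ∀ n₀ n₁ n₃ v m₀ m₁ m₂ w, n₀ ≠ m₀ ∨ n₁ ≠ m₁ →
      Commute (RUXZ n₀ n₁ n₃ v) (RUXY m₀ m₁ m₂ w) := fun n₀ n₁ n₃ v m₀ m₁ m₂ w h =>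
    (hUXZsupp n₀ n₁ n₃ v).commute_s10 (by simp; tauto) (hUXYsupp m₀ m₁ m₂ w)
  intro v
  set_option synthInstance.maxSize 1000 in
  have h := ModifiedTetrahedron.fuse hPQ hPS hPT hQS hQT hST hMTE v
  rw [hIU, hIX, hIY, hIZ, hρ, add_zero, one_smul] at h
  rw [hRfXYZ, hRfUYZ, hRfUXZ, hRfUXY]
  exact h
end
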